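/- Let $F = U_F \Sigma_\phi V_F^*$ be a singular value decomposition of a complex $m \times n$ matrix $F$, let $1 \leq K < N = \min(m,n)$, and let $\rho > 0$. If $\phi_K \geq (1+\rho)\phi_{K+1}$, then the truncated matrix $A = U_F \Sigma_{\tilde{\phi}} V_F^*$, where $\tilde{\phi}_j = \phi_j$ for $1 \leq j \leq K$ and $\tilde{\phi}_j = 0$ for $j > K$, is a solution of $\min_A \mathcal{I}^{**}(A) + \rho \|A - F\|^2$; that is, the proximal operator of $\mathcal{I}^{**}$ coincides with the best rank-$K$ approximation of $F$. -/

import Mathlib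

open Matrix Finset

/-- The `m × n` "diagonal" matrix whose `(i,i)` entry is `γ (i+1)` (singular values are
indexed starting from `1`). -/
noncomputable def svdDiag (m n : ℕ) (γ : ℕ → ℝ) : Matrix (Fin m) (Fin n) ℂ :=
  Matrix.of fun i j => if (i : ℕ) = (j : ℕ) then ((γ ((i : ℕ) + 1) : ℝ) : ℂ) else 0

/-- `X = U Σ_γ Vᴴ` is a singular value decomposition of `X`. -/
def IsSVD {m n : ℕ} (X : Matrix (Fin m) (Fin n) ℂ)
    (U : Matrix (Fin m) (Fin m) ℂ) (V : Matrix (Fin n) (Fin n) ℂ) (γ : ℕ → ℝ) : Prop :=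
  U ∈ Matrix.unitaryGroup (Fin m) ℂ ∧ V ∈ Matrix.unitaryGroup (Fin n) ℂ ∧
  (∀ j, 1 ≤ j → j < min m n → γ (j + 1) ≤ γ j) ∧
  (∀ j, 1 ≤ j → j ≤ min m n → 0 ≤ γ j) ∧
  X = U * svdDiag m n γ * Vᴴ

/-- The Frobenius (real) inner product `⟨A, B⟩ = Re tr (Bᴴ A)`. -/
noncomputable def frobInner {m n : ℕ} (A B : Matrix (Fin m) (Fin n) ℂ) : ℝ :=
  (Matrix.trace (Bᴴ * A)).re

/-- The squared Frobenius norm `‖A‖² = ⟨A, A⟩`. -/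
noncomputable def frobNormSq {m n : ℕ} (A : Matrix (Fin m) (Fin n) ℂ) : ℝ :=
  frobInner A A

/-- The Fenchel conjugate `𝓘*(B)` of `𝓘(A) = 𝓡_K(A) + ‖A - F‖²`. -/
noncomputable def Istar {m n : ℕ} (F : Matrix (Fin m) (Fin n) ℂ) (K : ℕ)
    (B : Matrix (Fin m) (Fin n) ℂ) : ℝ :=
  sSup {t : ℝ | ∃ A : Matrix (Fin m) (Fin n) ℂ,
    A.rank ≤ K ∧ t = frobInner A B - frobNormSq (A - F)}

/-- The biconjugate `𝓘**(A) = sup_B ⟨A,B⟩ - 𝓘*(B)`, i.e. the convex envelope of `𝓘`. -/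
noncomputable def Ibiconj {m n : ℕ} (F : Matrix (Fin m) (Fin n) ℂ) (K : ℕ)
    (A : Matrix (Fin m) (Fin n) ℂ) : ℝ :=
  sSup {t : ℝ | ∃ B : Matrix (Fin m) (Fin n) ℂ, t = frobInner A B - Istar F K B}

section FrobeniusInner

variable {m n : ℕ}

lemma frobInner_add_left (A B C : Matrix (Fin m) (Fin n) ℂ) :
    frobInner (A + B) C = frobInner A C + frobInner B C := by
  simp [frobInner, Matrix.mul_add]

lemma frobInner_sub_left (A B C : Matrix (Fin m) (Fin n) ℂ) :
    frobInner (A - B) C = frobInner A C - frobInner B C := by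
  simp [frobInner, Matrix.mul_sub]

lemma frobInner_smul_left (r : ℝ) (A C : Matrix (Fin m) (Fin n) ℂ) :
    frobInner (r • A) C = r * frobInner A C := by
  simp [frobInner]

lemma frobInner_sum_left {ι : Type*} (s : Finset ι) (A : ι → Matrix (Fin m) (Fin n) ℂ)
    (C : Matrix (Fin m) (Fin n) ℂ) :
    frobInner (∑ i ∈ s, A i) C = ∑ i ∈ s, frobInner (A i) C := by
  simp [frobInner, Matrix.mul_sum, Matrix.trace_sum]

lemma frobInner_comm (A B : Matrix (Fin m) (Fin n) ℂ) : frobInner A B = frobInner B A := by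
  have h : Bᴴ * A = (Aᴴ * B)ᴴ := by simp
  rw [frobInner, h, Matrix.trace_conjTranspose]
  simp [frobInner]

lemma frobInner_add_right (A B C : Matrix (Fin m) (Fin n) ℂ) :
    frobInner A (B + C) = frobInner A B + frobInner A C := by
  simp only [frobInner_comm A, frobInner_add_left]

lemma frobInner_sub_right (A B C : Matrix (Fin m) (Fin n) ℂ) :
    frobInner A (B - C) = frobInner A B - frobInner A C := by
  simp only [frobInner_comm A, frobInner_sub_left]

lemma frobInner_smul_right (r : ℝ) (A C : Matrix (Fin m) (Fin n) ℂ) :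
    frobInner A (r • C) = r * frobInner A C := by
  simp only [frobInner_comm A, frobInner_smul_left]

lemma frobNormSq_eq_sum_col (A : Matrix (Fin m) (Fin n) ℂ) :
    frobNormSq A = ∑ j, ‖(WithLp.toLp 2 (A.col j) : EuclideanSpace ℂ (Fin m))‖ ^ 2 := by
  simp only [frobNormSq, frobInner, Matrix.trace, Matrix.diag, Matrix.mul_apply,
    EuclideanSpace.norm_sq_eq, Complex.re_sum, Matrix.conjTranspose_apply, Matrix.col_apply]
  refine Finset.sum_congr rfl fun j _ => Finset.sum_congr rfl fun i _ => ?_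
  rw [Complex.star_def, ← Complex.normSq_eq_conj_mul_self, Complex.ofReal_re,
    Complex.normSq_eq_norm_sq]

lemma frobNormSq_nonneg (A : Matrix (Fin m) (Fin n) ℂ) : 0 ≤ frobNormSq A := by
  rw [frobNormSq_eq_sum_col]
  positivity

lemma frobNormSq_sub_comm (A B : Matrix (Fin m) (Fin n) ℂ) :
    frobNormSq (A - B) = frobNormSq (B - A) := by
  simp only [frobNormSq, frobInner_sub_left, frobInner_sub_right]
  ring

lemma frobInner_unitary_conj {U : Matrix (Fin m) (Fin m) ℂ} {V : Matrix (Fin n) (Fin n) ℂ}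
    (hU : U ∈ Matrix.unitaryGroup (Fin m) ℂ) (hV : V ∈ Matrix.unitaryGroup (Fin n) ℂ)
    (A B : Matrix (Fin m) (Fin n) ℂ) :
    frobInner (U * A * Vᴴ) (U * B * Vᴴ) = frobInner A B := by
  have hU' : Uᴴ * U = 1 := Matrix.mem_unitaryGroup_iff'.1 hU
  have hV' : Vᴴ * V = 1 := Matrix.mem_unitaryGroup_iff'.1 hV
  have h : (U * B * Vᴴ)ᴴ * (U * A * Vᴴ) = V * (Bᴴ * A) * Vᴴ := by
    calc (U * B * Vᴴ)ᴴ * (U * A * Vᴴ) = V * (Bᴴ * ((Uᴴ * U) * A)) * Vᴴ := by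
          simp [Matrix.mul_assoc]
      _ = _ := by rw [hU', Matrix.one_mul]
  rw [frobInner, h, Matrix.trace_mul_comm, ← Matrix.mul_assoc, hV', Matrix.one_mul, frobInner]

end FrobeniusInner

section SvdDiag

variable {m n : ℕ}

lemma svdDiag_add (γ δ : ℕ → ℝ) : svdDiag m n γ + svdDiag m n δ = svdDiag m n (γ + δ) := by
  ext i j
  by_cases h : (i : ℕ) = j <;> simp [svdDiag, h]

lemma svdDiag_sub (γ δ : ℕ → ℝ) : svdDiag m n γ - svdDiag m n δ = svdDiag m n (γ - δ) := by
  ext i j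
  by_cases h : (i : ℕ) = j <;> simp [svdDiag, h]

lemma smul_svdDiag (r : ℝ) (γ : ℕ → ℝ) : r • svdDiag m n γ = svdDiag m n (r • γ) := by
  ext i j
  by_cases h : (i : ℕ) = j <;> simp [svdDiag, h]

lemma frobInner_svdDiag_eq_zero {γ δ : ℕ → ℝ} (h : ∀ j, γ j * δ j = 0) :
    frobInner (svdDiag m n γ) (svdDiag m n δ) = 0 := by
  have h0 : (svdDiag m n δ)ᴴ * svdDiag m n γ = 0 := by
    ext i k
    rw [Matrix.mul_apply, Matrix.zero_apply]
    refine Finset.sum_eq_zero fun j _ => ?_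
    rcases mul_eq_zero.1 (h ((j : ℕ) + 1)) with h | h <;> simp [svdDiag, h]
  simp [frobInner, h0]

lemma rank_svdDiag_le {γ : ℕ → ℝ} {K : ℕ} (h : ∀ j, K < j → γ j = 0) :
    (svdDiag m n γ).rank ≤ K := by
  have hfac : svdDiag m n γ =
      svdDiag m n γ * Matrix.diagonal fun j : Fin n => if (j : ℕ) < K then (1 : ℂ) else 0 := by
    ext i j
    rw [Matrix.mul_diagonal]
    by_cases hj : (j : ℕ) < K
    · simp [hj]
    · have : (i : ℕ) = j → γ ((i : ℕ) + 1) = 0 := fun hij => h _ (by omega)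
      simpa [hj, svdDiag] using this
  rw [hfac]
  refine (Matrix.rank_mul_le_right _ _).trans ?_
  rw [Matrix.rank_diagonal, Fintype.card_subtype]
  simp only [ne_eq, ite_eq_right_iff, one_ne_zero, imp_false, not_not]
  calc #{j : Fin n | (j : ℕ) < K} ≤ #(Finset.range K) :=
        Finset.card_le_card_of_injOn (fun j : Fin n => (j : ℕ))
          (fun j hj => by simpa using hj) Fin.val_injective.injOn
    _ = K := Finset.card_range K

end SvdDiag

section EckartYoung

lemma norm_sq_sub_norm_sq_projection_le {E : Type*} [NormedAddCommGroup E]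
    [InnerProductSpace ℂ E] (S : Submodule ℂ E) [S.HasOrthogonalProjection] {y : E} (hy : y ∈ S)
    (x : E) : ‖x‖ ^ 2 - ‖S.orthogonalProjectionOnto x‖ ^ 2 ≤ ‖y - x‖ ^ 2 := by
  have h1 := S.norm_sq_eq_add_norm_sq_projection x
  have h2 := Sᗮ.norm_sq_eq_add_norm_sq_projection (y - x)
  have h3 : Sᗮ.orthogonalProjectionOnto (y - x) = -Sᗮ.orthogonalProjectionOnto x := by
    rw [map_sub, Submodule.orthogonalProjectionOnto_orthogonal_apply_eq_zero hy, zero_sub]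
  rw [h3, norm_neg] at h2
  nlinarith [sq_nonneg ‖Sᗮᗮ.orthogonalProjectionOnto (y - x)‖]

variable {m n : ℕ}

lemma sum_ite_val_eq_le (f : Fin m → ℝ) (hf : ∀ i, 0 ≤ f i) :
    ∑ j : Fin n, ∑ i : Fin m, (if (i : ℕ) = j then f i else 0) ≤ ∑ i, f i := by
  rw [Finset.sum_comm]
  refine Finset.sum_le_sum fun i _ => ?_
  by_cases hi : (i : ℕ) < n
  · rw [Finset.sum_eq_single ⟨i, hi⟩] <;> simp
    intro j hj hij
    exact absurd (Fin.ext hij.symm) hj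
  · rw [Finset.sum_eq_zero]
    · exact hf i
    · intro j _
      rw [if_neg]
      omega

/-- The `j`-th column of the rectangular identity matrix. -/
noncomputable def rectBasis (m : ℕ) (j : ℕ) : EuclideanSpace ℂ (Fin m) :=
  WithLp.toLp 2 fun i => if (i : ℕ) = j then 1 else 0

lemma rectBasis_of_lt {j : ℕ} (hj : j < m) :
    rectBasis m j = EuclideanSpace.single ⟨j, hj⟩ (1 : ℂ) := by
  ext i
  simp [rectBasis, Fin.ext_iff]

lemma rectBasis_of_le {j : ℕ} (hj : m ≤ j) : rectBasis m j = 0 := by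
  ext i
  have : (i : ℕ) ≠ j := by omega
  simp [rectBasis, this]

lemma sum_norm_inner_rectBasis_le (b : EuclideanSpace ℂ (Fin m)) :
    ∑ j : Fin n, ‖inner ℂ b (rectBasis m j)‖ ^ 2 ≤ ‖b‖ ^ 2 := by
  rw [EuclideanSpace.norm_sq_eq]
  refine le_trans (le_of_eq ?_) (sum_ite_val_eq_le (n := n) (fun i => ‖b i‖ ^ 2)
    fun i => by positivity)
  refine Finset.sum_congr rfl fun j _ => ?_
  rcases lt_or_ge (j : ℕ) m with hj | hj
  · rw [rectBasis_of_lt hj, Finset.sum_eq_single ⟨j, hj⟩]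
    · simp [EuclideanSpace.inner_single_right]
    · intro i _ hij
      rw [if_neg]
      exact fun h => hij (Fin.ext h)
    · simp
  · rw [rectBasis_of_le hj, Finset.sum_eq_zero]
    · simp
    · intro i _
      rw [if_neg]
      omega

lemma sum_norm_projection_rectBasis_le (S : Submodule ℂ (EuclideanSpace ℂ (Fin m))) :
    ∑ j : Fin n, ‖S.orthogonalProjectionOnto (rectBasis m j)‖ ^ 2 ≤ Module.finrank ℂ S := by
  let b := stdOrthonormalBasis ℂ S
  calc ∑ j : Fin n, ‖S.orthogonalProjectionOnto (rectBasis m j)‖ ^ 2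
      = ∑ j : Fin n, ∑ k, ‖inner ℂ (b k : EuclideanSpace ℂ (Fin m)) (rectBasis m j)‖ ^ 2 := by
        refine Finset.sum_congr rfl fun j _ => ?_
        rw [← b.sum_sq_norm_inner_right]
        simp only [Submodule.inner_orthogonalProjectionOnto_eq_of_mem_left]
    _ = ∑ k, ∑ j : Fin n, ‖inner ℂ (b k : EuclideanSpace ℂ (Fin m)) (rectBasis m j)‖ ^ 2 :=
        Finset.sum_comm
    _ ≤ ∑ k : Fin (Module.finrank ℂ S), (1 : ℝ) := by
        refine Finset.sum_le_sum fun k _ => (sum_norm_inner_rectBasis_le _).trans ?_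
        have : ‖(b k : EuclideanSpace ℂ (Fin m))‖ = 1 := b.orthonormal.1 k
        simp [this]
    _ = Module.finrank ℂ S := by simp

lemma toLp_col_svdDiag (γ : ℕ → ℝ) (j : Fin n) :
    (WithLp.toLp 2 ((svdDiag m n γ).col j) : EuclideanSpace ℂ (Fin m)) =
      ((γ ((j : ℕ) + 1) : ℝ) : ℂ) • rectBasis m j := by
  ext i
  by_cases h : (i : ℕ) = j <;> simp [svdDiag, rectBasis, h]

lemma finrank_span_toLp_col (Y : Matrix (Fin m) (Fin n) ℂ) :
    Module.finrank ℂ (Submodule.span ℂ (Set.range fun j =>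
      (WithLp.toLp 2 (Y.col j) : EuclideanSpace ℂ (Fin m)))) = Y.rank := by
  rw [Matrix.rank_eq_finrank_span_cols,
    ← LinearEquiv.finrank_map_eq (WithLp.linearEquiv 2 ℂ (Fin m → ℂ)).symm, Submodule.map_span,
    ← Set.range_comp]
  rfl

/-- **Eckart–Young** for rectangular diagonal matrices whose first `K` diagonal entries dominate
the remaining ones in absolute value. -/
lemma frobNormSq_tail_le_of_rank_le {K : ℕ} (hKm : K ≤ m) (hKn : K ≤ n) {z : ℕ → ℝ}
    {t : ℝ} (ht : 0 ≤ t)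
    (hhead : ∀ j, 1 ≤ j → j ≤ K → t ≤ z j ^ 2)
    (htail : ∀ j, K < j → j ≤ min m n → z j ^ 2 ≤ t)
    {Y : Matrix (Fin m) (Fin n) ℂ} (hY : Y.rank ≤ K) :
    frobNormSq (svdDiag m n fun j => if j ≤ K then 0 else z j) ≤
      frobNormSq (Y - svdDiag m n z) := by
  let y : Fin n → EuclideanSpace ℂ (Fin m) := fun j => WithLp.toLp 2 (Y.col j)
  let S := Submodule.span ℂ (Set.range y)
  have hS : Module.finrank ℂ S = Y.rank := finrank_span_toLp_col Y
  let q : Fin n → ℝ := fun j => ‖S.orthogonalProjectionOnto (rectBasis m j)‖ ^ 2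
  have hq0 (j) : 0 ≤ q j := by positivity
  have hqsum : ∑ j, q j ≤ K :=
    (sum_norm_projection_rectBasis_le S).trans (by rw [hS]; exact_mod_cast hY)
  have hcount : ∑ j : Fin n, (if (j : ℕ) < K then (1 : ℝ) else 0) = K := by
    rw [Fin.sum_univ_eq_sum_range (fun j => if j < K then (1 : ℝ) else 0) n,
      Finset.sum_ite, Finset.sum_const_zero, add_zero, Finset.sum_const, nsmul_eq_mul, mul_one]
    congr 1
    have : (Finset.range n).filter (· < K) = Finset.range K := by
      ext j
      simp only [Finset.mem_filter, Finset.mem_range]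
      omega
    rw [this, Finset.card_range]
  have hcol (j : Fin n) : ‖(WithLp.toLp 2 ((svdDiag m n fun j => if j ≤ K then 0 else z j).col j) :
        EuclideanSpace ℂ (Fin m))‖ ^ 2 + t * ((if (j : ℕ) < K then 1 else 0) - q j) ≤
      ‖(WithLp.toLp 2 ((Y - svdDiag m n z).col j) : EuclideanSpace ℂ (Fin m))‖ ^ 2 := by
    have hsub : (WithLp.toLp 2 ((Y - svdDiag m n z).col j) : EuclideanSpace ℂ (Fin m)) =
        y j - ((z ((j : ℕ) + 1) : ℝ) : ℂ) • rectBasis m j := by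
      rw [← toLp_col_svdDiag]
      rfl
    rw [hsub, toLp_col_svdDiag]
    refine le_trans ?_ (norm_sq_sub_norm_sq_projection_le S (Submodule.subset_span ⟨j, rfl⟩) _)
    have hq1 : q j ≤ ‖rectBasis m (j : ℕ)‖ ^ 2 :=
      pow_le_pow_left₀ (norm_nonneg _) (S.norm_orthogonalProjectionOnto_apply_le _) 2
    rw [map_smul, norm_smul, norm_smul, norm_smul, mul_pow, mul_pow, mul_pow, Complex.norm_real,
      Complex.norm_real, Real.norm_eq_abs, Real.norm_eq_abs, sq_abs, sq_abs]
    change _ ≤ _ - z ((j : ℕ) + 1) ^ 2 * q j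
    rcases lt_or_ge (j : ℕ) K with hj | hj
    · have hnorm : ‖rectBasis m (j : ℕ)‖ = 1 := by
        rw [rectBasis_of_lt (hj.trans_le hKm)]
        simp
      rw [hnorm] at hq1 ⊢
      have := hhead (j + 1) (by omega) (by omega)
      rw [if_pos (by omega), if_pos hj]
      nlinarith
    · rw [if_neg (by omega), if_neg (by omega)]
      rcases lt_or_ge (j : ℕ) m with hjm | hjm
      · have := htail (j + 1) (by omega) (by omega)
        nlinarith [hq0 j]
      · have hq : q j = 0 := by
          simp [q, rectBasis_of_le hjm]
        simp [hq]
  rw [frobNormSq_eq_sum_col, frobNormSq_eq_sum_col]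
  have hsum := Finset.sum_le_sum fun j (_ : j ∈ Finset.univ) => hcol j
  rw [Finset.sum_add_distrib, ← Finset.mul_sum, Finset.sum_sub_distrib, hcount] at hsum
  nlinarith

end EckartYoung

section Conjugate

variable {m n : ℕ} (F : Matrix (Fin m) (Fin n) ℂ) (K : ℕ)

lemma frobInner_sub_frobNormSq_eq (A B : Matrix (Fin m) (Fin n) ℂ) :
    frobInner A B - frobNormSq (A - F) =
      frobNormSq (F + (1 / 2 : ℝ) • B) - frobNormSq F - frobNormSq (A - (F + (1 / 2 : ℝ) • B)) := by
  simp only [frobNormSq, frobInner_add_left, frobInner_add_right, frobInner_sub_left,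
    frobInner_sub_right, frobInner_smul_left, frobInner_smul_right]
  rw [frobInner_comm B A, frobInner_comm B F, frobInner_comm F A]
  ring

lemma le_Istar (B : Matrix (Fin m) (Fin n) ℂ) {A : Matrix (Fin m) (Fin n) ℂ} (hA : A.rank ≤ K) :
    frobInner A B - frobNormSq (A - F) ≤ Istar F K B := by
  refine le_csSup ⟨frobNormSq (F + (1 / 2 : ℝ) • B) - frobNormSq F, ?_⟩ ⟨A, hA, rfl⟩
  rintro _ ⟨Y, -, rfl⟩
  rw [frobInner_sub_frobNormSq_eq]
  linarith [frobNormSq_nonneg (Y - (F + (1 / 2 : ℝ) • B))]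

lemma Istar_le {B : Matrix (Fin m) (Fin n) ℂ} {c : ℝ}
    (h : ∀ A : Matrix (Fin m) (Fin n) ℂ, A.rank ≤ K → frobInner A B - frobNormSq (A - F) ≤ c) :
    Istar F K B ≤ c := by
  refine csSup_le ⟨_, 0, by simp, rfl⟩ ?_
  rintro _ ⟨A, hA, rfl⟩
  exact h A hA

lemma Ibiconj_le {A : Matrix (Fin m) (Fin n) ℂ} (hA : A.rank ≤ K) :
    Ibiconj F K A ≤ frobNormSq (A - F) := by
  refine csSup_le ⟨_, 0, rfl⟩ ?_
  rintro _ ⟨B, rfl⟩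
  linarith [le_Istar F K B hA]

variable {K}

lemma le_Ibiconj (hK : 1 ≤ K) (hm : 0 < m) (hn : 0 < n) (X B : Matrix (Fin m) (Fin n) ℂ) :
    frobInner X B - Istar F K B ≤ Ibiconj F K X := by
  let N : ℝ := m * n
  have hN : 0 < N := by positivity
  let P : Fin m → Fin n → Matrix (Fin m) (Fin n) ℂ := fun i j => N • Matrix.single i j (X i j)
  have hP (i j) : (P i j).rank ≤ K := by
    have : P i j = Matrix.vecMulVec (Pi.single i ((N : ℂ) * X i j)) (Pi.single j 1) := by
      ext a b
      by_cases ha : i = a <;> by_cases hb : j = b <;>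
        simp [P, Matrix.vecMulVec_apply, ha, hb, eq_comm]
    rw [this]
    exact (Matrix.rank_vecMulVec_le _ _).trans hK
  have hX : N • X = ∑ i, ∑ j, P i j := by
    conv_lhs => rw [Matrix.matrix_eq_sum_single X]
    simp only [P, Finset.smul_sum]
  refine le_csSup ⟨(∑ i, ∑ j, frobNormSq (P i j - F)) / N, ?_⟩ ⟨B, rfl⟩
  rintro _ ⟨C, rfl⟩
  rw [le_div_iff₀ hN]
  have hsum : ∑ i, ∑ j, (frobInner (P i j) C - frobNormSq (P i j - F)) ≤
      ∑ _i : Fin m, ∑ _j : Fin n, Istar F K C :=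
    Finset.sum_le_sum fun i _ => Finset.sum_le_sum fun j _ => le_Istar F K C (hP i j)
  have hinner : N * frobInner X C = ∑ i, ∑ j, frobInner (P i j) C := by
    rw [← frobInner_smul_left, hX, frobInner_sum_left]
    simp only [frobInner_sum_left]
  simp only [Finset.sum_sub_distrib, ← hinner, Finset.sum_const, Finset.card_univ,
    Fintype.card_fin, nsmul_eq_mul] at hsum
  simp only [N] at hsum ⊢
  nlinarith

end Conjugate

/-- If `φ K ≥ (1+ρ) φ (K+1)`, then the proximal operator of `𝓘**` coincides with the best
rank-`K` approximation: the truncation `A = U_F Σ_φ̃ V_Fᴴ` (where `φ̃ j = φ j` for `j ≤ K`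
and `φ̃ j = 0` for `j > K`) solves `min_A 𝓘**(A) + ρ ‖A - F‖²`. -/
theorem prox_eq_truncation (m n K : ℕ) (hK1 : 1 ≤ K) (hK : K < min m n)
    (F : Matrix (Fin m) (Fin n) ℂ) (φ : ℕ → ℝ)
    (UF : Matrix (Fin m) (Fin m) ℂ) (VF : Matrix (Fin n) (Fin n) ℂ)
    (hF : IsSVD F UF VF φ) (ρ : ℝ) (hρ : 0 < ρ)
    (hgap : (1 + ρ) * φ (K + 1) ≤ φ K)
    (A : Matrix (Fin m) (Fin n) ℂ)
    (hA : A = UF * svdDiag m n (fun j => if j ≤ K then φ j else 0) * VFᴴ) :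
    ∀ X : Matrix (Fin m) (Fin n) ℂ,
      Ibiconj F K A + ρ * frobNormSq (A - F)
        ≤ Ibiconj F K X + ρ * frobNormSq (X - F) := by
  obtain ⟨hU, hV, hmono, hnonneg, hFsvd⟩ := hF
  have hKm : K < m := hK.trans_le (min_le_left _ _)
  have hKn : K < n := hK.trans_le (min_le_right _ _)
  intro X
  have hFA : F - A = UF * svdDiag m n (fun j => if j ≤ K then 0 else φ j) * VFᴴ := by
    rw [hA, hFsvd, ← Matrix.sub_mul, ← Matrix.mul_sub, svdDiag_sub]
    congr 3
    funext j
    by_cases h : j ≤ K <;> simp [h]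
  have hArank : A.rank ≤ K := by
    rw [hA]
    refine (Matrix.rank_mul_le_left _ _).trans ((Matrix.rank_mul_le_right _ _).trans ?_)
    exact rank_svdDiag_le fun j hj => if_neg (by omega)
  have horth : frobInner A (F - A) = 0 := by
    rw [hFA, hA, frobInner_unitary_conj hU hV]
    exact frobInner_svdDiag_eq_zero fun j => by by_cases h : j ≤ K <;> simp [h]
  have hdist := frobNormSq_sub_comm A F
  set B : Matrix (Fin m) (Fin n) ℂ := (2 * ρ) • (F - A) with hB
  have hIstar : Istar F K B ≤ -frobNormSq (A - F) := by
    refine Istar_le F K fun Y hY => ?_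
    have hanti : ∀ i j, 1 ≤ i → i ≤ j → j ≤ min m n → φ j ≤ φ i := by
      intro i j hi hij
      induction j, hij using Nat.le_induction with
      | base => exact fun _ => le_rfl
      | succ k hk ih => exact fun hkN => (hmono k (by omega) (by omega)).trans (ih (by omega))
    have hZ : F + (1 / 2 : ℝ) • B =
        UF * svdDiag m n (fun j => if j ≤ K then φ j else (1 + ρ) * φ j) * VFᴴ := by
      rw [hB, smul_smul, hFA, hFsvd, ← Matrix.smul_mul, ← Matrix.mul_smul, ← Matrix.add_mul,
        ← Matrix.mul_add, smul_svdDiag, svdDiag_add]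
      congr 3
      funext j
      by_cases h : j ≤ K <;> simp [h]
      ring
    have htail : (1 + ρ) ^ 2 * frobNormSq (F - A) ≤ frobNormSq (Y - (F + (1 / 2 : ℝ) • B)) := by
      have hUU : UF * UFᴴ = 1 := Matrix.mem_unitaryGroup_iff.1 hU
      have hVV : VF * VFᴴ = 1 := Matrix.mem_unitaryGroup_iff.1 hV
      have hYconj : Y = UF * (UFᴴ * Y * VF) * VFᴴ := by
        rw [Matrix.mul_assoc, Matrix.mul_assoc, hVV, Matrix.mul_one, ← Matrix.mul_assoc, hUU,
          Matrix.one_mul]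
      have hrank : (UFᴴ * Y * VF).rank ≤ K :=
        (Matrix.rank_mul_le_left _ _).trans ((Matrix.rank_mul_le_right _ _).trans hY)
      have hKnonneg : 0 ≤ φ (K + 1) := hnonneg _ (by omega) (by omega)
      have hEY := frobNormSq_tail_le_of_rank_le hKm.le hKn.le
        (z := fun j => if j ≤ K then φ j else (1 + ρ) * φ j) (sq_nonneg (φ K))
        (fun j hj hjK => by
          simp only [if_pos hjK]
          exact pow_le_pow_left₀ (hnonneg K hK1 hK.le) (hanti j K hj hjK hK.le) 2)
        (fun j hj hjN => by
          simp only [if_neg (not_le.2 hj)]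
          have h0 := hnonneg j (by omega) hjN
          have h1 := hanti (K + 1) j (by omega) hj hjN
          exact pow_le_pow_left₀ (by positivity)
            ((mul_le_mul_of_nonneg_left h1 (by positivity)).trans hgap) 2)
        hrank
      have hscale : (svdDiag m n fun j => if j ≤ K then 0 else
            if j ≤ K then φ j else (1 + ρ) * φ j) =
          (1 + ρ) • svdDiag m n fun j => if j ≤ K then 0 else φ j := by
        rw [smul_svdDiag]
        congr 1
        funext j
        by_cases h : j ≤ K <;> simp [h]
      rw [hZ, hFA, hYconj, ← Matrix.sub_mul, ← Matrix.mul_sub]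
      simp only [frobNormSq, frobInner_unitary_conj hU hV]
      rw [hscale] at hEY
      simp only [frobNormSq, frobInner_smul_left, frobInner_smul_right] at hEY
      linarith
    rw [frobInner_sub_frobNormSq_eq, hdist]
    have hexp : frobNormSq (F + (1 / 2 : ℝ) • B) =
        frobNormSq F + ((1 + ρ) ^ 2 - 1) * frobNormSq (F - A) := by
      have hAsplit : F + (1 / 2 : ℝ) • B = A + (1 + ρ) • (F - A) := by
        rw [hB]
        module
      have hFsplit : frobNormSq F = frobNormSq (A + (F - A)) := by rw [add_sub_cancel]
      rw [hAsplit, hFsplit]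
      simp only [frobNormSq, frobInner_add_left, frobInner_add_right, frobInner_smul_left,
        frobInner_smul_right, frobInner_comm (F - A) A, horth]
      ring
    linarith
  have hlow := le_Ibiconj F hK1 (by omega) (by omega) X B
  have hup := Ibiconj_le F K hArank
  have hsq : frobInner X B + ρ * frobNormSq (X - F) =
      ρ * frobNormSq (X - A) + ρ * frobNormSq (A - F) := by
    have hXA : frobInner X (F - A) = frobInner (X - A) (F - A) := by
      rw [frobInner_sub_left, horth, sub_zero]
    have hXF : X - F = (X - A) - (F - A) := by abel
    rw [hB, frobInner_smul_right, hXA, hXF, hdist]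
    generalize X - A = D
    generalize F - A = E
    simp only [frobNormSq, frobInner_sub_left, frobInner_sub_right, frobInner_comm E D]
    ring
  nlinarith [mul_nonneg hρ.le (frobNormSq_nonneg (X - A))]
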